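/- Fix an integer e ≥ 2 and κ = (κ₁, κ₂) ∈ (ℤ/eℤ)². Suppose λ is a bipartition with wt(λ) = 3 and i, j ∈ ℤ/eℤ satisfy j ∉ {i−1, i, i+1}, δ_i(λ) ≥ 1 and δ_j(λ) ≥ 1. Then λ does not have both an addable i-node and an addable j-node. -/

import Mathlib

namespace Wt3

/-- `f : ℕ → ℕ` (0-indexed: `f r` is the `(r+1)`-th part `λ_{r+1}`) is a partition if it is
weakly decreasing with finitely many nonzero terms. -/
def IsPartition (f : ℕ → ℕ) : Prop :=
  (∀ r, f (r + 1) ≤ f r) ∧ ∃ N, ∀ r, N ≤ r → f r = 0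

/-- A bipartition: an ordered pair of partitions, given as `lam : Fin 2 → ℕ → ℕ`. -/
def IsBipartition (lam : Fin 2 → ℕ → ℕ) : Prop := ∀ a, IsPartition (lam a)

/-- Nodes `(r, c, a)` with 0-indexed row `r`, column `c`, and component `a : Fin 2`. -/
abbrev Node := ℕ × ℕ × Fin 2

/-- The Young diagram of a bipartition: `(r,c,a)` is a node iff `c < λ⁽ᵃ⁾_r` (0-indexed,
corresponding to `c+1 ≤ λ⁽ᵃ⁾_{r+1}` in 1-indexed terms). -/
def Diagram (lam : Fin 2 → ℕ → ℕ) : Set Node := {x | x.2.1 < lam x.2.2 x.1}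

/-- A node of `[λ]` is removable if deleting it leaves the Young diagram of a bipartition. -/
def IsRemovable (lam : Fin 2 → ℕ → ℕ) (x : Node) : Prop :=
  x ∈ Diagram lam ∧ ∃ mu, IsBipartition mu ∧ Diagram mu = Diagram lam \ {x}

/-- A node not in `[λ]` is addable if adding it gives the Young diagram of a bipartition. -/
def IsAddable (lam : Fin 2 → ℕ → ℕ) (x : Node) : Prop :=
  x ∉ Diagram lam ∧ ∃ mu, IsBipartition mu ∧ Diagram mu = Diagram lam ∪ {x}

/-- The residue `c − r + κ_a ∈ ℤ/eℤ` of a node `(r,c,a)` (0-indexing leaves this unchanged). -/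
def res (e : ℕ) (κ : Fin 2 → ZMod e) (x : Node) : ZMod e :=
  (x.2.1 : ZMod e) - (x.1 : ZMod e) + κ x.2.2

/-- `c_i(λ)`: the number of `i`-nodes of `λ`. -/
noncomputable def cnt (e : ℕ) (κ : Fin 2 → ZMod e) (lam : Fin 2 → ℕ → ℕ) (i : ZMod e) : ℕ :=
  Set.ncard {x : Node | x ∈ Diagram lam ∧ res e κ x = i}

/-- The number of removable `i`-nodes of `λ`. -/
noncomputable def remCount (e : ℕ) (κ : Fin 2 → ZMod e) (lam : Fin 2 → ℕ → ℕ) (i : ZMod e) : ℕ :=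
  Set.ncard {x : Node | IsRemovable lam x ∧ res e κ x = i}

/-- The number of addable `i`-nodes of `λ`. -/
noncomputable def addCount (e : ℕ) (κ : Fin 2 → ZMod e) (lam : Fin 2 → ℕ → ℕ) (i : ZMod e) : ℕ :=
  Set.ncard {x : Node | IsAddable lam x ∧ res e κ x = i}

/-- `δ_i(λ)`: number of removable `i`-nodes minus number of addable `i`-nodes. -/
noncomputable def delta (e : ℕ) (κ : Fin 2 → ZMod e) (lam : Fin 2 → ℕ → ℕ) (i : ZMod e) : ℤ :=
  (remCount e κ lam i : ℤ) - (addCount e κ lam i : ℤ)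

/-- The weight `wt(λ) = c_{κ₁}(λ) + c_{κ₂}(λ) − ½ Σ_{i ∈ ℤ/eℤ} (c_i(λ) − c_{i+1}(λ))²`. -/
noncomputable def wt (e : ℕ) (κ : Fin 2 → ZMod e) (lam : Fin 2 → ℕ → ℕ) : ℚ :=
  (cnt e κ lam (κ 0) : ℚ) + (cnt e κ lam (κ 1) : ℚ) -
    (1 / 2) * ∑ j ∈ Finset.range e,
      ((cnt e κ lam (j : ZMod e) : ℚ) - (cnt e κ lam ((j : ZMod e) + 1) : ℚ)) ^ 2

/-- The rim of `λ`: nodes `(r,c,a) ∈ [λ]` with `(r+1,c+1,a) ∉ [λ]`. -/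
def Rim (lam : Fin 2 → ℕ → ℕ) : Set Node :=
  {x | x ∈ Diagram lam ∧ (x.1 + 1, x.2.1 + 1, x.2.2) ∉ Diagram lam}

/-- One step along a strip: `y` is one step to the right of, or one step above, `x`
(in the same component). -/
def Step (x y : Node) : Prop :=
  y.2.2 = x.2.2 ∧ ((y.1 = x.1 ∧ y.2.1 = x.2.1 + 1) ∨ (x.1 = y.1 + 1 ∧ y.2.1 = x.2.1))

/-- A rim hook of `λ`: a nonempty subset of the rim, contained in a single component,
forming a connected strip, whose removal leaves the Young diagram of a bipartition. -/
def IsRimHook (lam : Fin 2 → ℕ → ℕ) (H : Finset Node) : Prop :=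
  H.Nonempty ∧ ↑H ⊆ Rim lam ∧ (∀ x ∈ H, ∀ y ∈ H, x.2.2 = y.2.2) ∧
    (∃ l : List Node, l.Chain' Step ∧ ∀ x : Node, x ∈ l ↔ x ∈ H) ∧
    ∃ mu, IsBipartition mu ∧ Diagram mu = Diagram lam \ ↑H

/-- A bicore: a bipartition with no rim `e`-hooks. -/
def IsBicore (e : ℕ) (lam : Fin 2 → ℕ → ℕ) : Prop :=
  ¬ ∃ H : Finset Node, IsRimHook lam H ∧ H.card = e

/-- The beta-set `{λ_r + k − r : 1 ≤ r ≤ k}` of a partition with charge `k` (0-indexed form). -/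
def betaSet (f : ℕ → ℕ) (k : ℕ) : Finset ℕ :=
  (Finset.range k).image fun r => f r + (k - (r + 1))

/-- The number of nonzero parts of a partition. -/
noncomputable def len (f : ℕ → ℕ) : ℕ := Set.ncard {r : ℕ | f r ≠ 0}

/-- `(k₁,k₂)` is a bicharge for `κ` relative to `λ`. -/
def IsBicharge (e : ℕ) (κ : Fin 2 → ZMod e) (lam : Fin 2 → ℕ → ℕ) (k₁ k₂ : ℕ) : Prop :=
  (k₁ : ZMod e) = κ 0 ∧ (k₂ : ZMod e) = κ 1 ∧ len (lam 0) ≤ k₁ ∧ len (lam 1) ≤ k₂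

/-- `γ_x(λ)`: beads of residue `x` in the first beta-set minus those in the second. -/
def gamma (e : ℕ) (lam : Fin 2 → ℕ → ℕ) (k₁ k₂ : ℕ) (x : ZMod e) : ℤ :=
  (((betaSet (lam 0) k₁).filter fun b : ℕ => (b : ZMod e) = x).card : ℤ) -
    (((betaSet (lam 1) k₂).filter fun b : ℕ => (b : ZMod e) = x).card : ℤ)

/-- `x` is above (higher than) `y`. -/
def Above (x y : Node) : Prop := x.2.2 < y.2.2 ∨ (x.2.2 = y.2.2 ∧ x.1 < y.1)

/-- A normal `i`-node: a removable `i`-node `x` such that for every addable `i`-node `y`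
below `x`, the removable `i`-nodes strictly between `x` and `y` outnumber the addable ones
(equivalently, the `−` sign of `x` survives in the reduced `i`-signature). -/
def IsNormal (e : ℕ) (κ : Fin 2 → ZMod e) (lam : Fin 2 → ℕ → ℕ) (i : ZMod e) (x : Node) :
    Prop :=
  IsRemovable lam x ∧ res e κ x = i ∧
    ∀ y : Node, IsAddable lam y → res e κ y = i → Above x y →
      Set.ncard {z : Node | IsAddable lam z ∧ res e κ z = i ∧ Above x z ∧ Above z y} <
        Set.ncard {z : Node | IsRemovable lam z ∧ res e κ z = i ∧ Above x z ∧ Above z y}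

/-- The good `i`-node: the highest normal `i`-node. -/
def IsGood (e : ℕ) (κ : Fin 2 → ZMod e) (lam : Fin 2 → ℕ → ℕ) (i : ZMod e) (x : Node) :
    Prop :=
  IsNormal e κ lam i x ∧ ∀ y, IsNormal e κ lam i y → y = x ∨ Above x y

/-- An antinormal `i`-node: a removable `i`-node `x` such that for every addable `i`-node `y`
above `x`, the removable `i`-nodes strictly between `y` and `x` outnumber the addable ones
(equivalently, the `−` sign of `x` survives in the antireduced `i`-signature). -/
def IsAntinormal (e : ℕ) (κ : Fin 2 → ZMod e) (lam : Fin 2 → ℕ → ℕ) (i : ZMod e) (x : Node) :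
    Prop :=
  IsRemovable lam x ∧ res e κ x = i ∧
    ∀ y : Node, IsAddable lam y → res e κ y = i → Above y x →
      Set.ncard {z : Node | IsAddable lam z ∧ res e κ z = i ∧ Above y z ∧ Above z x} <
        Set.ncard {z : Node | IsRemovable lam z ∧ res e κ z = i ∧ Above y z ∧ Above z x}

/-- The antigood `i`-node: the lowest antinormal `i`-node. -/
def IsAntigood (e : ℕ) (κ : Fin 2 → ZMod e) (lam : Fin 2 → ℕ → ℕ) (i : ZMod e) (x : Node) :
    Prop :=
  IsAntinormal e κ lam i x ∧ ∀ y, IsAntinormal e κ lam i y → y = x ∨ Above y x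

/-- `μ →ᵢ λ`: `μ` is obtained from `λ` by removing the good `i`-node. -/
def RemGoodAt (e : ℕ) (κ : Fin 2 → ZMod e) (i : ZMod e) (mu lam : Fin 2 → ℕ → ℕ) : Prop :=
  ∃ x, IsGood e κ lam i x ∧ Diagram mu = Diagram lam \ {x}

/-- `μ ⇒ᵢ λ`: `μ` is obtained from `λ` by removing the antigood `i`-node. -/
def RemAntigoodAt (e : ℕ) (κ : Fin 2 → ZMod e) (i : ZMod e) (mu lam : Fin 2 → ℕ → ℕ) : Prop :=
  ∃ x, IsAntigood e κ lam i x ∧ Diagram mu = Diagram lam \ {x}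

/-- `μ → λ`: `μ` is obtained from the bipartition `λ` by removing a good node. -/
def RemGood (e : ℕ) (κ : Fin 2 → ZMod e) (mu lam : Fin 2 → ℕ → ℕ) : Prop :=
  IsBipartition mu ∧ IsBipartition lam ∧ ∃ i, RemGoodAt e κ i mu lam

/-- A bipartition is restricted if it lies in the class of the empty bipartition under the
equivalence relation generated by `→`. -/
def IsRestricted (e : ℕ) (κ : Fin 2 → ZMod e) (lam : Fin 2 → ℕ → ℕ) : Prop :=
  Relation.EqvGen (RemGood e κ) lam (fun _ _ => 0)

/-- A partition is `e`-restricted if `λ_r − λ_{r+1} < e` for all `r`. -/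
def IsERestricted (e : ℕ) (f : ℕ → ℕ) : Prop := ∀ r, f r < f (r + 1) + e

/-- The conjugate partition: `λ′_r = #{c : λ_c ≥ r}` (0-indexed form). -/
noncomputable def conjP (f : ℕ → ℕ) : ℕ → ℕ := fun r => Set.ncard {c : ℕ | r + 1 ≤ f c}

/-- The conjugate bipartition `λ′ = ((λ⁽²⁾)′ | (λ⁽¹⁾)′)`. -/
noncomputable def conjB (lam : Fin 2 → ℕ → ℕ) : Fin 2 → ℕ → ℕ := fun a => conjP (lam (1 - a))

/-- `|λ|` for a partition. -/
noncomputable def psize (f : ℕ → ℕ) : ℕ := Set.ncard {p : ℕ × ℕ | p.2 < f p.1}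

/-- `|λ|` for a bipartition. -/
noncomputable def bsize (lam : Fin 2 → ℕ → ℕ) : ℕ := psize (lam 0) + psize (lam 1)

/-- `λ_1 + ⋯ + λ_r`. -/
def psum (f : ℕ → ℕ) (r : ℕ) : ℕ := ∑ j ∈ Finset.range r, f j

/-- The dominance order on bipartitions: `λ ⊵ μ`. -/
def Dominates (lam mu : Fin 2 → ℕ → ℕ) : Prop :=
  ∀ r : ℕ, psum (mu 0) r ≤ psum (lam 0) r ∧
    psize (mu 0) + psum (mu 1) r ≤ psize (lam 0) + psum (lam 1) r

/-! Single-partition versions (for statement 11). -/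

abbrev Node1 := ℕ × ℕ

def Diagram1 (f : ℕ → ℕ) : Set Node1 := {x | x.2 < f x.1}

def IsRemovable1 (f : ℕ → ℕ) (x : Node1) : Prop :=
  x ∈ Diagram1 f ∧ ∃ g, IsPartition g ∧ Diagram1 g = Diagram1 f \ {x}

def IsAddable1 (f : ℕ → ℕ) (x : Node1) : Prop :=
  x ∉ Diagram1 f ∧ ∃ g, IsPartition g ∧ Diagram1 g = Diagram1 f ∪ {x}

def res1 (e : ℕ) (k : ZMod e) (x : Node1) : ZMod e := (x.2 : ZMod e) - (x.1 : ZMod e) + k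

def Rim1 (f : ℕ → ℕ) : Set Node1 := {x | x ∈ Diagram1 f ∧ (x.1 + 1, x.2 + 1) ∉ Diagram1 f}

def Step1 (x y : Node1) : Prop :=
  (y.1 = x.1 ∧ y.2 = x.2 + 1) ∨ (x.1 = y.1 + 1 ∧ y.2 = x.2)

def IsRimHook1 (f : ℕ → ℕ) (H : Finset Node1) : Prop :=
  H.Nonempty ∧ ↑H ⊆ Rim1 f ∧
    (∃ l : List Node1, l.Chain' Step1 ∧ ∀ x : Node1, x ∈ l ↔ x ∈ H) ∧
    ∃ g, IsPartition g ∧ Diagram1 g = Diagram1 f \ ↑H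

/-- An `e`-core: a partition with no rim `e`-hooks. -/
def IsECore (e : ℕ) (f : ℕ → ℕ) : Prop := ¬ ∃ H : Finset Node1, IsRimHook1 f H ∧ H.card = e

/-! The statement. -/

lemma IsPartition.antitone {f : ℕ → ℕ} (hf : IsPartition f) : Antitone f :=
  antitone_nat_of_succ_le hf.1

lemma IsBipartition.exists_bound {lam : Fin 2 → ℕ → ℕ} (h : IsBipartition lam) :
    ∃ N, ∀ a r, N ≤ r → lam a r = 0 := by
  obtain ⟨N₀, h₀⟩ := (h 0).2
  obtain ⟨N₁, h₁⟩ := (h 1).2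
  refine ⟨max N₀ N₁, fun a r hr => ?_⟩
  fin_cases a
  · exact h₀ r (le_trans (le_max_left _ _) hr)
  · exact h₁ r (le_trans (le_max_right _ _) hr)

lemma IsBipartition.sup {lam mu : Fin 2 → ℕ → ℕ} (h : IsBipartition lam)
    (h' : IsBipartition mu) : IsBipartition fun a r => max (lam a r) (mu a r) := by
  intro a
  obtain ⟨h₁, N, hN⟩ := h a
  obtain ⟨h₂, M, hM⟩ := h' a
  refine ⟨fun r => max_le_max (h₁ r) (h₂ r), max N M, fun r hr => ?_⟩
  simp [hN r (le_trans (le_max_left _ _) hr), hM r (le_trans (le_max_right _ _) hr)]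

lemma IsBipartition.inf {lam mu : Fin 2 → ℕ → ℕ} (h : IsBipartition lam)
    (h' : IsBipartition mu) : IsBipartition fun a r => min (lam a r) (mu a r) := by
  intro a
  obtain ⟨h₁, N, hN⟩ := h a
  obtain ⟨h₂, -⟩ := h' a
  exact ⟨fun r => min_le_min (h₁ r) (h₂ r), N, fun r hr => by simp [hN r hr]⟩

lemma diagram_sup (lam mu : Fin 2 → ℕ → ℕ) :
    Diagram (fun a r => max (lam a r) (mu a r)) = Diagram lam ∪ Diagram mu := by
  ext x
  simp [Diagram]

lemma diagram_inf (lam mu : Fin 2 → ℕ → ℕ) :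
    Diagram (fun a r => min (lam a r) (mu a r)) = Diagram lam ∩ Diagram mu := by
  ext x
  simp [Diagram]

/-- The nodes satisfying `P`, counted row by row. -/
lemma ncard_diagram {lam : Fin 2 → ℕ → ℕ} {N : ℕ}
    (hN : ∀ a r, N ≤ r → lam a r = 0) (P : Node → Prop) [DecidablePred P] :
    Set.ncard {x : Node | x ∈ Diagram lam ∧ P x} =
      ∑ a, ∑ r ∈ Finset.range N, ∑ c ∈ Finset.range (lam a r), if P (r, c, a) then 1 else 0 := by
  classical
  have hset : {x : Node | x ∈ Diagram lam ∧ P x} =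
      (((Finset.univ.sigma fun a => (Finset.range N).sigma fun r =>
        (Finset.range (lam a r)).filter fun c => P (r, c, a)).image
        fun s : (Σ _ : Fin 2, Σ _ : ℕ, ℕ) => ((s.2.1, s.2.2, s.1) : Node) : Finset Node) :
          Set Node) := by
    ext ⟨r, c, a⟩
    simp only [Diagram, Set.mem_ofPred_eq, Finset.coe_image, Set.mem_image, Finset.mem_coe,
      Finset.mem_sigma, Finset.mem_univ, true_and, Finset.mem_range, Finset.mem_filter]
    constructor
    · rintro ⟨hc, hP⟩
      refine ⟨⟨a, r, c⟩, ⟨?_, hc, hP⟩, rfl⟩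
      by_contra hr
      have := hN a r (not_lt.mp hr)
      omega
    · rintro ⟨⟨a', r', c'⟩, ⟨-, hc, hP⟩, heq⟩
      simp only [Prod.mk.injEq] at heq
      obtain ⟨rfl, rfl, rfl⟩ := heq
      exact ⟨hc, hP⟩
  rw [hset, Set.ncard_coe_finset, Finset.card_image_of_injective, Finset.card_sigma]
  · simp only [Finset.card_sigma, Finset.card_filter]
  · rintro ⟨a, r, c⟩ ⟨a', r', c'⟩ heq
    simp only [Prod.mk.injEq] at heq
    obtain ⟨rfl, rfl, rfl⟩ := heq
    rfl

lemma IsBipartition.finite_diagram {lam : Fin 2 → ℕ → ℕ} (h : IsBipartition lam) :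
    (Diagram lam).Finite := by
  obtain ⟨N, hN⟩ := h.exists_bound
  refine Set.Finite.subset (Set.Finite.prod (Set.finite_Iio N)
    (Set.Finite.prod (Set.finite_Iio (lam 0 0 + lam 1 0)) Set.finite_univ)) ?_
  rintro ⟨r, c, a⟩ hx
  simp only [Diagram, Set.mem_ofPred_eq] at hx
  have hanti := (h a).antitone (Nat.zero_le r)
  simp only [Set.mem_prod, Set.mem_Iio, Set.mem_univ, and_true]
  refine ⟨?_, ?_⟩
  · by_contra hr
    have := hN a r (not_lt.mp hr)
    omega
  · fin_cases a <;> simp at hx hanti <;> omega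

lemma isRemovable_iff {lam : Fin 2 → ℕ → ℕ} (h : IsBipartition lam) (r c : ℕ) (a : Fin 2) :
    IsRemovable lam (r, c, a) ↔ c + 1 = lam a r ∧ lam a (r + 1) < lam a r := by
  constructor
  · rintro ⟨hx, mu, hmu, hD⟩
    have key : ∀ r' c', c' < mu a r' ↔ c' < lam a r' ∧ ¬ (r' = r ∧ c' = c) := fun r' c' => by
      have := Set.ext_iff.mp hD (r', c', a)
      simpa [Diagram] using this
    simp only [Diagram, Set.mem_ofPred_eq] at hx
    have h₁ := key r (c + 1)
    have h₂ := key r c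
    have h₃ := key (r + 1) c
    have h₄ := (hmu a).1 r
    have h₅ := (h a).1 r
    simp at h₁ h₂ h₃
    omega
  · rintro ⟨hc, hlt⟩
    refine ⟨by simp [Diagram]; omega,
      fun b s => if b = a ∧ s = r then c else lam b s, fun b => ?_, ?_⟩
    · obtain ⟨h₁, N, hN⟩ := h b
      refine ⟨fun s => ?_, N, fun s hs => ?_⟩
      · have := h₁ s
        dsimp only
        split_ifs with h₂ h₃ h₃
        · exact le_rfl
        · obtain ⟨rfl, rfl⟩ := h₂
          omega
        · obtain ⟨rfl, rfl⟩ := h₃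
          omega
        · exact this
      · have := hN s hs
        dsimp only
        split_ifs with h₂
        · obtain ⟨rfl, rfl⟩ := h₂
          omega
        · exact this
    · ext ⟨s, d, b⟩
      simp only [Diagram, Set.mem_ofPred_eq, Set.mem_sdiff, Set.mem_singleton_iff, Prod.mk.injEq]
      split_ifs with h₂
      · obtain ⟨rfl, rfl⟩ := h₂
        simp
        omega
      · constructor
        · intro hd
          exact ⟨hd, fun ⟨h₃, _, h₅⟩ => h₂ ⟨h₅, h₃⟩⟩
        · exact fun hd => hd.1

lemma isAddable_iff {lam : Fin 2 → ℕ → ℕ} (h : IsBipartition lam) (r c : ℕ) (a : Fin 2) :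
    IsAddable lam (r, c, a) ↔ c = lam a r ∧ (r = 0 ∨ lam a r < lam a (r - 1)) := by
  constructor
  · rintro ⟨hx, mu, hmu, hD⟩
    have key : ∀ r' c', c' < mu a r' ↔ c' < lam a r' ∨ (r' = r ∧ c' = c) := fun r' c' => by
      have := Set.ext_iff.mp hD (r', c', a)
      simp [Diagram] at this
      rw [this]
      tauto
    simp only [Diagram, Set.mem_ofPred_eq] at hx
    have h₁ := key r (lam a r)
    have h₂ := key r c
    simp at h₁ h₂
    refine ⟨by omega, ?_⟩
    rcases Nat.eq_zero_or_pos r with hr | hr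
    · exact Or.inl hr
    · have h₃ := key (r - 1) c
      have h₄ := (hmu a).1 (r - 1)
      rw [Nat.sub_add_cancel hr] at h₄
      omega
  · rintro ⟨rfl, hr⟩
    refine ⟨by simp [Diagram],
      fun b s => if b = a ∧ s = r then lam a r + 1 else lam b s, fun b => ?_, ?_⟩
    · obtain ⟨h₁, N, hN⟩ := h b
      refine ⟨fun s => ?_, max N (r + 1), fun s hs => ?_⟩
      · have := h₁ s
        dsimp only
        split_ifs with h₂ h₃ h₃
        · exact le_rfl
        · obtain ⟨rfl, rfl⟩ := h₂
          simp at hr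
          omega
        · obtain ⟨rfl, rfl⟩ := h₃
          omega
        · exact this
      · have := hN s (le_trans (le_max_left _ _) hs)
        have h₄ := le_trans (le_max_right _ _) hs
        dsimp only
        rw [if_neg (by omega)]
        exact this
    · ext ⟨s, d, b⟩
      simp only [Diagram, Set.mem_ofPred_eq, Set.mem_union, Set.mem_singleton_iff, Prod.mk.injEq]
      split_ifs with h₂
      · obtain ⟨rfl, rfl⟩ := h₂
        simp
        omega
      · constructor
        · exact Or.inl
        · rintro (hd | ⟨h₃, _, h₅⟩)
          · exact hd
          · exact absurd ⟨h₅, h₃⟩ h₂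

/-- A set with at most one node in each row, counted row by row. -/
lemma ncard_rows (N : ℕ) (Q : Fin 2 → ℕ → Prop) [∀ a r, Decidable (Q a r)] (g : Fin 2 → ℕ → ℕ)
    (S : Set Node)
    (hS : ∀ r c a, (r, c, a) ∈ S ↔ r < N ∧ c = g a r ∧ Q a r) :
    S.ncard = ∑ a, ∑ r ∈ Finset.range N, if Q a r then 1 else 0 := by
  classical
  have hset : S = (((Finset.univ.sigma fun a => (Finset.range N).filter fun r => Q a r).image
        fun s : (Σ _ : Fin 2, ℕ) => ((s.2, g s.1 s.2, s.1) : Node) : Finset Node) :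
          Set Node) := by
    ext ⟨r, c, a⟩
    simp only [hS, Finset.coe_image, Set.mem_image, Finset.mem_coe,
      Finset.mem_sigma, Finset.mem_univ, true_and, Finset.mem_range, Finset.mem_filter]
    constructor
    · rintro ⟨hr, rfl, hQ⟩
      exact ⟨⟨a, r⟩, ⟨hr, hQ⟩, rfl⟩
    · rintro ⟨⟨a', r'⟩, ⟨hr, hQ⟩, heq⟩
      simp only [Prod.mk.injEq] at heq
      obtain ⟨rfl, rfl, rfl⟩ := heq
      exact ⟨hr, rfl, hQ⟩
  rw [hset, Set.ncard_coe_finset, Finset.card_image_of_injective, Finset.card_sigma]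
  · simp only [Finset.card_filter]
  · rintro ⟨a, r⟩ ⟨a', r'⟩ heq
    simp only [Prod.mk.injEq] at heq
    obtain ⟨rfl, -, rfl⟩ := heq
    rfl

/-- Second difference of residue counts along a row starting at residue `t`. -/
lemma row_second_difference {e : ℕ} (t i : ZMod e) (l : ℕ) :
    ∑ c ∈ Finset.range l, (2 * (if (c : ZMod e) + t = i then (1 : ℤ) else 0)
        - (if (c : ZMod e) + t = i - 1 then 1 else 0)
        - (if (c : ZMod e) + t = i + 1 then 1 else 0)) =
      (if t = i then 1 else 0) - (if t - 1 = i then 1 else 0)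
        + (if (l : ZMod e) + t - 1 = i then 1 else 0) - (if (l : ZMod e) + t = i then 1 else 0) := by
  induction l with
  | zero => simp
  | succ l ih =>
    rw [Finset.sum_range_succ, ih]
    have h₁ : ((l : ZMod e) + t = i - 1) ↔ (((l + 1 : ℕ) : ZMod e) + t = i) := by
      push_cast
      constructor <;> intro h <;> linear_combination h
    have h₂ : ((l : ZMod e) + t = i + 1) ↔ ((l : ZMod e) + t - 1 = i) := by
      constructor <;> intro h <;> linear_combination h
    have h₃ : (((l + 1 : ℕ) : ZMod e) + t - 1 = i) ↔ ((l : ZMod e) + t = i) := by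
      push_cast
      constructor <;> intro h <;> linear_combination h
    simp only [h₁, h₂, h₃]
    ring

/-- One component of the formula for `δ_i` in terms of the residue counts. -/
lemma component_delta {e : ℕ} {f : ℕ → ℕ} (hf : IsPartition f) (k i : ZMod e) (N : ℕ) :
    ∑ r ∈ Finset.range N,
        (if f (r + 1) < f r ∧ ((f r - 1 : ℕ) : ZMod e) - r + k = i then (1 : ℤ) else 0)
      - ∑ r ∈ Finset.range (N + 1),
        (if (r = 0 ∨ f r < f (r - 1)) ∧ (f r : ZMod e) - r + k = i then (1 : ℤ) else 0) =
      ∑ r ∈ Finset.range N, ((if k - r = i then (1 : ℤ) else 0)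
        - (if k - r - 1 = i then 1 else 0)
        + (if (f r : ZMod e) + (k - r) - 1 = i then 1 else 0)
        - (if (f r : ZMod e) + (k - r) = i then 1 else 0))
      + (if k - N = i then 1 else 0) - (if (f N : ZMod e) + (k - N) = i then 1 else 0)
      - (if k = i then 1 else 0) := by
  induction N with
  | zero =>
    simp only [Finset.sum_range_succ, Finset.sum_range_zero, Nat.cast_zero, sub_zero, true_or,
      true_and]
    ring
  | succ N ih =>
    simp only [Finset.sum_range_succ] at ih ⊢
    have h₀ : (k - ((N + 1 : ℕ) : ZMod e) = i) ↔ (k - N - 1 = i) := by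
      push_cast
      constructor <;> intro h <;> linear_combination h
    have h₁ : ((f (N + 1) : ZMod e) + (k - ((N + 1 : ℕ) : ZMod e)) = i) ↔
        ((f (N + 1) : ZMod e) - ((N + 1 : ℕ) : ZMod e) + k = i) := by
      constructor <;> intro h <;> linear_combination h
    simp only [h₀, h₁, Nat.add_sub_cancel, Nat.add_one_ne_zero, false_or]
    rcases (hf.1 N).lt_or_eq with hlt | heq
    · have h₂ : (((f N - 1 : ℕ) : ZMod e) - N + k = i) ↔ ((f N : ZMod e) + (k - N) - 1 = i) := by
        rw [Nat.cast_sub (by omega)]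
        push_cast
        constructor <;> intro h <;> linear_combination h
      simp only [hlt, true_and, h₂]
      linarith
    · have h₂ : ((f N : ZMod e) - ((N + 1 : ℕ) : ZMod e) + k = i) ↔
          ((f N : ZMod e) + (k - N) - 1 = i) := by
        push_cast
        constructor <;> intro h <;> linear_combination h
      simp only [heq, lt_irrefl, false_and, if_false, h₂]
      linarith

lemma delta_eq (e : ℕ) (κ : Fin 2 → ZMod e) {lam : Fin 2 → ℕ → ℕ} (h : IsBipartition lam)
    (i : ZMod e) :
    delta e κ lam i = 2 * (cnt e κ lam i : ℤ) - cnt e κ lam (i - 1) - cnt e κ lam (i + 1)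
      - ∑ a, if κ a = i then 1 else 0 := by
  obtain ⟨N, hN⟩ := h.exists_bound
  have hrem : remCount e κ lam i = ∑ a, ∑ r ∈ Finset.range N,
      if lam a (r + 1) < lam a r ∧ ((lam a r - 1 : ℕ) : ZMod e) - r + κ a = i then 1 else 0 := by
    refine ncard_rows N _ (fun a r => lam a r - 1) _ fun r c a => ?_
    simp only [Set.mem_ofPred_eq, isRemovable_iff h, res]
    constructor
    · rintro ⟨⟨h₁, h₂⟩, h₃⟩
      have hc : c = lam a r - 1 := by omega
      refine ⟨?_, hc, h₂, hc ▸ h₃⟩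
      by_contra hr
      have := hN a r (not_lt.mp hr)
      omega
    · rintro ⟨-, rfl, h₂, h₃⟩
      exact ⟨⟨by omega, h₂⟩, h₃⟩
  have hadd : addCount e κ lam i = ∑ a, ∑ r ∈ Finset.range (N + 1),
      if (r = 0 ∨ lam a r < lam a (r - 1)) ∧ (lam a r : ZMod e) - r + κ a = i
        then 1 else 0 := by
    refine ncard_rows (N + 1) _ (fun a r => lam a r) _ fun r c a => ?_
    simp only [Set.mem_ofPred_eq, isAddable_iff h, res]
    constructor
    · rintro ⟨⟨rfl, h₂⟩, h₃⟩
      refine ⟨?_, rfl, h₂, h₃⟩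
      by_contra hr
      have := hN a (r - 1) (by omega)
      omega
    · rintro ⟨-, rfl, h₂, h₃⟩
      exact ⟨⟨rfl, h₂⟩, h₃⟩
  have hcnt : ∀ k, (cnt e κ lam k : ℤ) = ∑ a, ∑ r ∈ Finset.range N,
      ∑ c ∈ Finset.range (lam a r), if (c : ZMod e) + (κ a - r) = k then (1 : ℤ) else 0 := by
    intro k
    rw [cnt, ncard_diagram hN fun x => res e κ x = k]
    push_cast
    simp only [res]
    refine Finset.sum_congr rfl fun a _ => Finset.sum_congr rfl fun r _ =>
      Finset.sum_congr rfl fun c _ => ?_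
    simp only [show (c : ZMod e) - r + κ a = c + (κ a - r) by ring]
  rw [delta, hrem, hadd, hcnt, hcnt, hcnt]
  push_cast
  rw [← Finset.sum_sub_distrib, Finset.mul_sum, ← Finset.sum_sub_distrib,
    ← Finset.sum_sub_distrib, ← Finset.sum_sub_distrib]
  refine Finset.sum_congr rfl fun a _ => ?_
  rw [component_delta (h a), hN a N le_rfl]
  simp only [← row_second_difference, Finset.sum_sub_distrib, Finset.mul_sum]
  simp

lemma cnt_of_diagram_union {e : ℕ} {κ : Fin 2 → ZMod e} {lam mu : Fin 2 → ℕ → ℕ}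
    (h : IsBipartition lam) {x : Node} (hx : x ∉ Diagram lam)
    (hD : Diagram mu = Diagram lam ∪ {x}) (k : ZMod e) :
    cnt e κ mu k = cnt e κ lam k + if k = res e κ x then 1 else 0 := by
  unfold cnt
  split_ifs with hk
  · rw [← Set.ncard_insert_of_notMem (a := x) (fun hmem => hx hmem.1)
      (h.finite_diagram.subset fun y hy => hy.1)]
    congr 1
    ext y
    simp only [hD, Set.mem_ofPred_eq, Set.mem_union, Set.mem_singleton_iff, Set.mem_insert_iff]
    constructor
    · rintro ⟨h₁ | h₁, h₂⟩
      · exact Or.inr ⟨h₁, h₂⟩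
      · exact Or.inl h₁
    · rintro (rfl | ⟨h₁, h₂⟩)
      · exact ⟨Or.inr rfl, hk.symm⟩
      · exact ⟨Or.inl h₁, h₂⟩
  · rw [add_zero]
    congr 1
    ext y
    simp only [hD, Set.mem_ofPred_eq, Set.mem_union, Set.mem_singleton_iff]
    constructor
    · rintro ⟨h₁ | rfl, h₂⟩
      · exact ⟨h₁, h₂⟩
      · exact absurd h₂.symm hk
    · exact fun hy => ⟨Or.inl hy.1, hy.2⟩

lemma sum_range_natCast {e : ℕ} [NeZero e] (g : ZMod e → ℚ) :
    ∑ j ∈ Finset.range e, g (j : ZMod e) = ∑ x, g x := by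
  refine Finset.sum_bij' (fun j _ => (j : ZMod e)) (fun x _ => x.val) ?_ ?_ ?_ ?_ ?_
  · simp
  · intro x _
    simpa using ZMod.val_lt x
  · intro j hj
    exact ZMod.val_cast_of_lt (Finset.mem_range.mp hj)
  · intro x _
    simp
  · simp

/-- Adding an `i`-node changes the weight by `-δ_i - 1`. -/
lemma wt_of_diagram_union {e : ℕ} (he : 2 ≤ e) {κ : Fin 2 → ZMod e} {lam mu : Fin 2 → ℕ → ℕ}
    (h : IsBipartition lam) {x : Node} (hx : x ∉ Diagram lam)
    (hD : Diagram mu = Diagram lam ∪ {x}) :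
    wt e κ mu = wt e κ lam - delta e κ lam (res e κ x) - 1 := by
  have : NeZero e := ⟨by omega⟩
  have : Fact (1 < e) := ⟨he⟩
  have hc := cnt_of_diagram_union (κ := κ) h hx hD
  rw [delta_eq e κ h]
  set i := res e κ x
  simp only [wt, hc]
  rw [sum_range_natCast fun y => (((cnt e κ lam y + if y = i then 1 else 0 : ℕ) : ℚ) -
      ((cnt e κ lam (y + 1) + if y + 1 = i then 1 else 0 : ℕ) : ℚ)) ^ 2,
    sum_range_natCast fun y => ((cnt e κ lam y : ℚ) - (cnt e κ lam (y + 1) : ℚ)) ^ 2]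
  have hne : i ≠ i - 1 := fun h' => one_ne_zero (sub_eq_self.mp h'.symm)
  have hterm : ∀ y : ZMod e, (((cnt e κ lam y + if y = i then 1 else 0 : ℕ) : ℚ) -
      ((cnt e κ lam (y + 1) + if y + 1 = i then 1 else 0 : ℕ) : ℚ)) ^ 2 =
      ((cnt e κ lam y : ℚ) - (cnt e κ lam (y + 1) : ℚ)) ^ 2
      + (if y = i then 2 * ((cnt e κ lam i : ℚ) - cnt e κ lam (i + 1)) + 1 else 0)
      + (if y = i - 1 then 1 - 2 * ((cnt e κ lam (i - 1) : ℚ) - cnt e κ lam i) else 0) := by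
    intro y
    by_cases h₁ : y = i
    · subst h₁
      rw [if_pos rfl, if_neg (by simp), if_pos rfl, if_neg hne]
      push_cast
      ring
    · by_cases h₂ : y = i - 1
      · subst h₂
        simp only [sub_add_cancel, if_true, if_neg h₁]
        push_cast
        ring
      · rw [if_neg h₁, if_neg (fun h' => h₂ (eq_sub_of_add_eq h')), if_neg h₁, if_neg h₂]
        push_cast
        ring
  simp only [hterm, Finset.sum_add_distrib, Finset.sum_ite_eq', Finset.mem_univ, if_true]
  push_cast
  rw [Fin.sum_univ_two]
  ring

lemma IsRemovable.exists_remove {lam : Fin 2 → ℕ → ℕ} {x : Node} (hx : IsRemovable lam x) :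
    ∃ mu, IsBipartition mu ∧ x ∉ Diagram mu ∧ Diagram lam = Diagram mu ∪ {x} ∧
      ∀ y, IsRemovable lam y → y ≠ x → IsRemovable mu y := by
  obtain ⟨hx, mu, hmu, hD⟩ := hx
  refine ⟨mu, hmu, by simp [hD], ?_, ?_⟩
  · rw [hD, Set.sdiff_union_self, Set.union_eq_left.mpr (by simpa using hx)]
  · rintro y ⟨hy, nu, hnu, hD'⟩ hne
    refine ⟨by simp [hD, hy, hne], _, hmu.inf hnu, ?_⟩
    rw [diagram_inf, hD, hD']
    ext z
    simp only [Set.mem_inter_iff, Set.mem_sdiff]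
    tauto

lemma exists_isRemovable {lam : Fin 2 → ℕ → ℕ} (h : IsBipartition lam)
    (hne : (Diagram lam).Nonempty) : ∃ x, IsRemovable lam x := by
  obtain ⟨⟨r, c, a⟩, hx⟩ := hne
  simp only [Diagram, Set.mem_ofPred_eq] at hx
  have hex : ∃ n, lam a n = 0 := by
    obtain ⟨N, hN⟩ := (h a).2
    exact ⟨N, hN N le_rfl⟩
  classical
  have hfind := Nat.find_spec hex
  have hanti := (h a).antitone (Nat.zero_le r)
  obtain ⟨n, hn⟩ : ∃ n, Nat.find hex = n + 1 := by
    refine Nat.exists_eq_succ_of_ne_zero fun h0 => ?_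
    rw [h0] at hfind
    omega
  have hpos := Nat.find_min hex (m := n) (by omega)
  rw [hn] at hfind
  exact ⟨(n, lam a n - 1, a), (isRemovable_iff h _ _ _).mpr ⟨by omega, by omega⟩⟩

/-- The weight is at least the product of the numbers of removable and addable `i`-nodes. -/
lemma remCount_mul_addCount_le_wt {e : ℕ} (he : 2 ≤ e) (κ : Fin 2 → ZMod e) (n : ℕ) :
    ∀ lam, IsBipartition lam → (Diagram lam).ncard = n → ∀ i,
      (remCount e κ lam i : ℚ) * addCount e κ lam i ≤ wt e κ lam := by
  induction n with
  | zero =>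
    intro lam h hn i
    have hD : Diagram lam = ∅ := (Set.ncard_eq_zero h.finite_diagram).mp hn
    have hrem : remCount e κ lam i = 0 := by simp [remCount, IsRemovable, hD]
    have hcnt : ∀ k, cnt e κ lam k = 0 := fun k => by simp [cnt, hD]
    simp [hrem, wt, hcnt]
  | succ n ih =>
    intro lam h hn
    have key : ∀ x, IsRemovable lam x → (remCount e κ lam (res e κ x) : ℚ) *
        addCount e κ lam (res e κ x) ≤ wt e κ lam := by
      intro x hx
      obtain ⟨mu, hmu, hxmu, hD, hrem⟩ := hx.exists_remove
      have hcard : (Diagram mu).ncard = n := by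
        rw [hD, Set.union_singleton, Set.ncard_insert_of_notMem hxmu hmu.finite_diagram] at hn
        omega
      have hih := ih mu hmu hcard (res e κ x)
      have hwt := wt_of_diagram_union he (κ := κ) hmu hxmu hD
      have hc := cnt_of_diagram_union (κ := κ) hmu hxmu hD
      set i := res e κ x
      have hr : remCount e κ lam i ≤ remCount e κ mu i + 1 := by
        refine le_trans (Set.ncard_le_ncard (t := insert x {y | IsRemovable mu y ∧ res e κ y = i})
          ?_ ?_) (Set.ncard_insert_le _ _)
        · rintro y ⟨hy, hyi⟩
          by_cases hyx : y = x
          · exact Or.inl hyx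
          · exact Or.inr ⟨hrem y hy hyx, hyi⟩
        · exact (hmu.finite_diagram.subset fun y hy => hy.1.1).insert x
      have hδ : delta e κ lam i = delta e κ mu i + 2 := by
        have : Fact (1 < e) := ⟨he⟩
        rw [delta_eq e κ h, delta_eq e κ hmu, hc, hc, hc, if_pos rfl, if_neg (by simp),
          if_neg (by simp)]
        push_cast
        ring
      simp only [delta] at hδ hwt
      have hr' : (remCount e κ lam i : ℚ) ≤ remCount e κ mu i + 1 := by exact_mod_cast hr
      have hδ' : (remCount e κ lam i : ℚ) - addCount e κ lam i =
        remCount e κ mu i - addCount e κ mu i + 2 := by exact_mod_cast hδ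
      push_cast at hwt
      have h₀ : (0 : ℚ) ≤ remCount e κ mu i := Nat.cast_nonneg _
      have h₁ : (0 : ℚ) ≤ addCount e κ lam i := Nat.cast_nonneg _
      nlinarith [mul_nonneg (sub_nonneg.mpr hr') (add_nonneg h₀ h₁),
        mul_nonneg (sub_nonneg.mpr hr') h₁, mul_nonneg (sub_nonneg.mpr hr') h₀]
    intro i
    by_cases hi : ∃ x, IsRemovable lam x ∧ res e κ x = i
    · obtain ⟨x, hx, rfl⟩ := hi
      exact key x hx
    · have hrem : remCount e κ lam i = 0 := by
        have hempty : {x | IsRemovable lam x ∧ res e κ x = i} = ∅ :=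
          Set.eq_empty_of_forall_notMem fun x hx => hi ⟨x, hx⟩
        rw [remCount, hempty, Set.ncard_empty]
      obtain ⟨x, hx⟩ := exists_isRemovable h (Set.nonempty_of_ncard_ne_zero (by omega))
      rw [hrem, Nat.cast_zero, zero_mul]
      exact le_trans (by positivity) (key x hx)

lemma wt_nonneg {e : ℕ} (he : 2 ≤ e) (κ : Fin 2 → ZMod e) {lam : Fin 2 → ℕ → ℕ}
    (h : IsBipartition lam) : 0 ≤ wt e κ lam :=
  le_trans (by positivity) (remCount_mul_addCount_le_wt he κ _ lam h rfl 0)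

theorem stmt15 (e : ℕ) (he : 2 ≤ e) (κ : Fin 2 → ZMod e) (lam : Fin 2 → ℕ → ℕ)
    (hlam : IsBipartition lam) (hwt : wt e κ lam = 3) (i j : ZMod e)
    (hj1 : j ≠ i - 1) (hj2 : j ≠ i) (hj3 : j ≠ i + 1)
    (hdi : 1 ≤ delta e κ lam i) (hdj : 1 ≤ delta e κ lam j) :
    ¬ ((∃ x : Node, IsAddable lam x ∧ res e κ x = i) ∧
        (∃ x : Node, IsAddable lam x ∧ res e κ x = j)) := by
  rintro ⟨⟨x, ⟨hx, mu, hmu, hDmu⟩, hxi⟩, ⟨y, ⟨hy, nu, hnu, hDnu⟩, hyj⟩⟩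
  have hyx : y ≠ x := by
    rintro rfl
    exact hj2 (hyj.symm.trans hxi)
  have hwmu := wt_of_diagram_union he (κ := κ) hlam hx hDmu
  have hcmu := cnt_of_diagram_union (κ := κ) hlam hx hDmu
  have hymu : y ∉ Diagram mu := by simp [hDmu, hy, hyx]
  have hD : Diagram (fun a r => max (mu a r) (nu a r)) = Diagram mu ∪ {y} := by
    rw [diagram_sup, hDmu, hDnu]
    ext z
    simp only [Set.mem_union]
    tauto
  have hw := wt_of_diagram_union he (κ := κ) hmu hymu hD
  have hδ : delta e κ mu j = delta e κ lam j := by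
    rw [delta_eq e κ hmu, delta_eq e κ hlam, hcmu, hcmu, hcmu, hxi, if_neg hj2,
      if_neg fun h' => hj3 (eq_add_of_sub_eq h'), if_neg fun h' => hj1 (eq_sub_of_add_eq h')]
    simp
  rw [hyj, hδ, hwmu, hxi, hwt] at hw
  have h₀ := wt_nonneg he κ (hmu.sup hnu)
  have hdi' : (1 : ℚ) ≤ delta e κ lam i := by exact_mod_cast hdi
  have hdj' : (1 : ℚ) ≤ delta e κ lam j := by exact_mod_cast hdj
  linarith

end Wt3
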